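/- Let τ, η ∈ OP_n with τ̄ ≤ η̄. Then there exists an ordered set partition σ_max ∈ OP_n such that {σ ∈ OP_n : σ ⋏ η = τ} = {σ ∈ OP_n : τ ≤ σ ≤ σ_max}; moreover this set, with the order induced from OP_n, is order-isomorphic to the product poset IP_{p_1} × IP_{p_2} × ⋯ × IP_{p_t}, where p_1,…,p_t are the lengths of the ascending runs of the sequence (m_1,…,m_s) and t = |τ| − asc_η(τ). -/

import Mathlib

open Finset

namespace OSPpaper

/-- A *block* is a subset of `[n] = Fin n`. -/
abbrev Block (n : ℕ) := Finset (Fin n)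

/-- `l` is an ordered set partition of the ground set `E ⊆ [n]`:
a finite sequence of pairwise disjoint nonempty subsets of `E` whose union is `E`. -/
def IsOSP {n : ℕ} (E : Finset (Fin n)) (l : List (Block n)) : Prop :=
  (∀ P ∈ l, P.Nonempty) ∧ l.Pairwise (fun P Q => Disjoint P Q) ∧
    (∀ P ∈ l, P ⊆ E) ∧ ∀ i ∈ E, ∃ P ∈ l, i ∈ P

/-- Union of a list of blocks. -/
def unionList {n : ℕ} (l : List (Block n)) : Block n := l.foldr (· ∪ ·) ∅

/-- The order on ordered set partitions: `π ≤ σ` iff every block of `σ` is the union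
of a contiguous run of blocks of `π` (runs taken in order). -/
def OSPle {n : ℕ} (π σ : List (Block n)) : Prop :=
  ∃ L : List (List (Block n)), L.flatten = π ∧ σ = L.map unionList

/-- The restriction `σ⌋_P`: intersect every block with `P` and delete the empty intersections. -/
def restrict {n : ℕ} (σ : List (Block n)) (P : Block n) : List (Block n) :=
  (σ.map (fun Q => Q ∩ P)).filter (fun Q => decide (Q ≠ ∅))

/-- The quasi-meet `π ⋏ σ`: the concatenation `σ⌋_{P₁} σ⌋_{P₂} ⋯ σ⌋_{P_p}`. -/
def qmeet {n : ℕ} (π σ : List (Block n)) : List (Block n) :=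
  (π.map (fun P => restrict σ P)).flatten

/-- Refinement: every block of `σ` is contained in some block of `τ`.
(As a relation on the underlying unordered partitions, this is the refinement order;
in particular `refines τ η` says `τ̄ ≤ η̄`.) -/
def refines {n : ℕ} (σ τ : List (Block n)) : Prop := ∀ P ∈ σ, ∃ Q ∈ τ, P ⊆ Q

/-- An interval partition of `[m]`, with its blocks listed in (the unique) increasing order:
an ordered set partition whose consecutive blocks are completely ordered. -/
def IsIP {m : ℕ} (l : List (Finset (Fin m))) : Prop :=
  IsOSP Finset.univ l ∧ l.Chain' (fun P Q => ∀ a ∈ P, ∀ b ∈ Q, a < b)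

/-- The (0-based) index `π(k)` of the block of `π` containing `k`. -/
def blockIdx {n : ℕ} (π : List (Block n)) (k : Fin n) : ℕ :=
  π.findIdx (fun P => decide (k ∈ P))

/-- The ordered kernel `κ(i₁,…,iₙ)` of a tuple: the nonempty level sets of the tuple,
listed in increasing order of the value. -/
def kernel {n : ℕ} (i : Fin n → ℕ) : List (Block n) :=
  ((Finset.image i Finset.univ).sort (· ≤ ·)).map
    (fun v => Finset.univ.filter (fun k => i k = v))

/-- `[σ:π] = ∏_{P ∈ π} #(σ⌋_P)`. -/
def colonNum {n : ℕ} (σ π : List (Block n)) : ℕ :=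
  (π.map (fun P => (restrict σ P).length)).prod

/-- `[σ:π]! = ∏_{P ∈ π} #(σ⌋_P)!`. -/
def colonFac {n : ℕ} (σ π : List (Block n)) : ℕ :=
  (π.map (fun P => Nat.factorial (restrict σ P).length)).prod

/-- For `τ̄ ≤ η̄` the sequence `(m_1,…,m_s)`: `m_i` is the (0-based) index of the block of `η`
containing the `i`-th block of `τ`. -/
def mseq {n : ℕ} (τ η : List (Block n)) : List ℕ :=
  τ.map (fun T => η.findIdx (fun E => decide (T ⊆ E)))

/-- number of ascents of a sequence -/
def ascL (l : List ℕ) : ℕ := ((l.zip l.tail).filter (fun p => decide (p.1 < p.2))).length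
/-- number of descents of a sequence -/
def desL (l : List ℕ) : ℕ := ((l.zip l.tail).filter (fun p => decide (p.2 < p.1))).length
/-- number of plateaux of a sequence -/
def platL (l : List ℕ) : ℕ := ((l.zip l.tail).filter (fun p => decide (p.1 = p.2))).length

/-- `asc_η(τ)` -/
def ascN {n : ℕ} (τ η : List (Block n)) : ℕ := ascL (mseq τ η)
/-- `des_η(τ)` -/
def desN {n : ℕ} (τ η : List (Block n)) : ℕ := desL (mseq τ η)
/-- `plat_η(τ)` -/
def platN {n : ℕ} (τ η : List (Block n)) : ℕ := platL (mseq τ η)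

/-- lengths of the maximal ascending runs of a sequence -/
def ascRunLengths (l : List ℕ) : List ℕ :=
  (l.splitBy (fun a b => decide (a < b))).map List.length
/-- lengths of the maximal level (constant) runs of a sequence -/
def levelRunLengths (l : List ℕ) : List ℕ :=
  (l.splitBy (fun a b => decide (a = b))).map List.length

/-- `μ̃(σ,π) = (−1)^{|σ|−|π|} / [σ:π]` (real-valued). -/
noncomputable def muR {n : ℕ} (σ π : List (Block n)) : ℝ :=
  (-1 : ℝ) ^ (σ.length - π.length) / (colonNum σ π : ℝ)

/-- `ζ̃(σ,π) = 1 / [σ:π]!` (real-valued). -/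
noncomputable def zetaR {n : ℕ} (σ π : List (Block n)) : ℝ :=
  1 / (colonFac σ π : ℝ)

/-- The Weisner coefficient `w(τ,η) = ∑_{σ ⋏ η = τ} μ̃(σ, 1̂ₙ)`. -/
noncomputable def wcoef {n : ℕ} (τ η : List (Block n)) : ℝ :=
  ∑ᶠ σ ∈ {σ : List (Block n) | IsOSP Finset.univ σ ∧ qmeet σ η = τ},
    muR σ [(Finset.univ : Block n)]

/-- The Goldberg coefficient `g(τ,η) = ∑_{σ ≥ τ} ζ̃(τ,σ) w(σ,η)`. -/
noncomputable def gcoef {n : ℕ} (τ η : List (Block n)) : ℝ :=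
  ∑ᶠ σ ∈ {σ : List (Block n) | IsOSP Finset.univ σ ∧ OSPle τ σ}, zetaR τ σ * wcoef σ η

section SplitLengths

variable {α : Type*}

theorem splitLengths_append (a b : List ℕ) (l : List α) :
    (a ++ b).splitLengths l
      = a.splitLengths (l.take a.sum) ++ b.splitLengths (l.drop a.sum) := by
  induction a generalizing l with
  | nil => simp
  | cons k a ih => simp [ih, List.take_take, List.drop_take]

theorem splitLengths_map_length (L : List (List α)) :
    (L.map List.length).splitLengths L.flatten = L := by
  induction L with
  | nil => rfl
  | cons p L ih => simp [ih]

theorem exists_regroup_splitLengths (K : List (List ℕ)) (l : List α)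
    (h : K.flatten.sum = l.length) :
    ∃ N : List (List (List α)), N.flatten = K.flatten.splitLengths l ∧
      N.map List.flatten = (K.map List.sum).splitLengths l := by
  induction K generalizing l with
  | nil => exact ⟨[], rfl, rfl⟩
  | cons k K ih =>
    simp only [List.flatten_cons, List.sum_append] at h
    obtain ⟨N, h₁, h₂⟩ := ih (l.drop k.sum) (by rw [List.length_drop]; omega)
    refine ⟨k.splitLengths (l.take k.sum) :: N, ?_, ?_⟩
    · simp [h₁, splitLengths_append]
    · simp [h₂, List.flatten_splitLengths]

theorem exists_flatten_eq_of_map_eq_flatten {β : Type*} {f : α → β} {l : List α}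
    {L : List (List β)} (h : l.map f = L.flatten) :
    ∃ N : List (List α), N.flatten = l ∧ N.map (List.map f) = L := by
  induction L generalizing l with
  | nil => exact ⟨[], by simpa using h.symm, rfl⟩
  | cons p L ih =>
    obtain ⟨l₁, l₂, rfl, rfl, h₂⟩ := List.map_eq_append_iff.1 h
    obtain ⟨N, rfl, rfl⟩ := ih h₂
    exact ⟨l₁ :: N, rfl, rfl⟩

end SplitLengths

/-- `c` is a composition of `m`, given as a list of positive parts. -/
def IsComp (m : ℕ) (c : List ℕ) : Prop := (∀ x ∈ c, 0 < x) ∧ c.sum = m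

/-- `c'` arises from `c` by summing contiguous groups of parts. -/
def CompLe (c c' : List ℕ) : Prop :=
  ∃ K : List (List ℕ), K.flatten = c ∧ K.map List.sum = c'

theorem isComp_map_length {α : Type*} {L : List (List α)} (h : ∀ p ∈ L, p ≠ []) :
    IsComp L.flatten.length (L.map List.length) := by
  refine ⟨?_, by simp [List.length_flatten]⟩
  simpa [List.length_pos_iff] using h

theorem IsComp.flatten_splitLengths {α : Type*} {l : List α} {c : List ℕ}
    (hc : IsComp l.length c) : (c.splitLengths l).flatten = l :=
  List.flatten_splitLengths _ _ hc.2.ge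

theorem IsComp.map_length_splitLengths {α : Type*} {l : List α} {c : List ℕ}
    (hc : IsComp l.length c) : (c.splitLengths l).map List.length = c :=
  List.map_splitLengths_length _ _ hc.2.le

theorem IsComp.ne_nil_of_mem_splitLengths {α : Type*} {l : List α} {c : List ℕ}
    (hc : IsComp l.length c) : ∀ p ∈ c.splitLengths l, p ≠ [] := by
  intro p hp
  have : p.length ∈ c := by
    rw [← hc.map_length_splitLengths]
    exact List.mem_map_of_mem hp
  exact List.length_pos_iff.1 (hc.1 _ this)

section Compositions

theorem append_inj_of_sum_eq {a b a' b' : List ℕ} (h : a ++ b = a' ++ b')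
    (hs : a.sum = a'.sum) (ha : ∀ x ∈ a, 0 < x) (ha' : ∀ x ∈ a', 0 < x) :
    a = a' ∧ b = b' := by
  induction a generalizing a' with
  | nil =>
    cases a' with
    | nil => exact ⟨rfl, h⟩
    | cons y a' => have := ha' y (by simp); simp at hs; omega
  | cons x a ih =>
    cases a' with
    | nil => have := ha x (by simp); simp at hs; omega
    | cons y a' =>
      simp only [List.cons_append, List.cons.injEq] at h
      obtain ⟨rfl, h⟩ := h
      simp only [List.sum_cons, Nat.add_left_cancel_iff] at hs
      obtain ⟨rfl, rfl⟩ := ih h hs (fun z hz => ha z (by simp [hz]))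
        (fun z hz => ha' z (by simp [hz]))
      exact ⟨rfl, rfl⟩

theorem CompLe.sum_eq {c c' : List ℕ} (h : CompLe c c') : c.sum = c'.sum := by
  obtain ⟨K, rfl, rfl⟩ := h
  simp [List.sum_flatten]

theorem compLe_append {a b a' b' : List ℕ} (hs : a.sum = a'.sum)
    (hab : ∀ x ∈ a ++ b, 0 < x) :
    CompLe (a ++ b) (a' ++ b') ↔ CompLe a a' ∧ CompLe b b' := by
  constructor
  · rintro ⟨K, h₁, h₂⟩
    obtain ⟨K₁, K₂, rfl, rfl, rfl⟩ := List.map_eq_append_iff.1 h₂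
    rw [List.flatten_append] at h₁
    obtain ⟨rfl, rfl⟩ := append_inj_of_sum_eq h₁ (by simp [hs, List.sum_flatten])
      (fun x hx => hab x (by rw [← h₁]; simp only [List.mem_append]; exact Or.inl hx))
      (fun x hx => hab x (by simp [hx]))
    exact ⟨⟨K₁, rfl, rfl⟩, ⟨K₂, rfl, rfl⟩⟩
  · rintro ⟨⟨K₁, rfl, rfl⟩, ⟨K₂, rfl, rfl⟩⟩
    exact ⟨K₁ ++ K₂, by simp, by simp⟩

theorem compLe_flatten_ofFn {t : ℕ} (f g : Fin t → List ℕ) (hs : ∀ j, (f j).sum = (g j).sum)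
    (hf : ∀ j, ∀ x ∈ f j, 0 < x) :
    CompLe (List.ofFn f).flatten (List.ofFn g).flatten ↔ ∀ j, CompLe (f j) (g j) := by
  induction t with
  | zero => simpa using ⟨[], rfl, rfl⟩
  | succ t ih =>
    rw [List.ofFn_succ, List.ofFn_succ, List.flatten_cons, List.flatten_cons,
      compLe_append (hs 0), ih _ _ (fun j => hs j.succ) (fun j => hf j.succ), Fin.forall_fin_succ]
    intro x hx
    simp only [List.mem_append, List.mem_flatten, List.mem_ofFn, exists_exists_eq_and] at hx
    obtain hx | ⟨j, hx⟩ := hx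
    · exact hf _ _ hx
    · exact hf _ _ hx

theorem flatten_ofFn_injective_of_sum {t : ℕ} (f g : Fin t → List ℕ)
    (hs : ∀ j, (f j).sum = (g j).sum) (hf : ∀ j, ∀ x ∈ f j, 0 < x) (hg : ∀ j, ∀ x ∈ g j, 0 < x)
    (h : (List.ofFn f).flatten = (List.ofFn g).flatten) : ∀ j, f j = g j := by
  induction t with
  | zero => exact fun j => j.elim0
  | succ t ih =>
    rw [List.ofFn_succ, List.ofFn_succ, List.flatten_cons, List.flatten_cons] at h
    obtain ⟨h₀, h₁⟩ := append_inj_of_sum_eq h (hs 0) (hf 0) (hg 0)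
    rw [Fin.forall_fin_succ]
    exact ⟨h₀, ih _ _ (fun j => hs j.succ) (fun j => hf j.succ) (fun j => hg j.succ) h₁⟩

/-- The compositions below `r` are a product of the compositions of the parts of `r`. -/
theorem exists_equiv_compLe (r : List ℕ) :
    ∃ e : {c : List ℕ // IsComp r.sum c ∧ CompLe c r} ≃
        ((j : Fin r.length) → {c : List ℕ // IsComp (r.get j) c}),
      ∀ c c', CompLe c.1 c'.1 ↔ ∀ j, CompLe (e c j).1 (e c' j).1 := by
  have hle (f : (j : Fin r.length) → {c : List ℕ // IsComp (r.get j) c}) :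
      CompLe (List.ofFn fun j => (f j).1).flatten r := by
    refine ⟨_, rfl, ?_⟩
    rw [List.map_ofFn]
    conv_rhs => rw [← List.ofFn_get r]
    exact congrArg List.ofFn (funext fun j => (f j).2.2)
  let g (f : (j : Fin r.length) → {c : List ℕ // IsComp (r.get j) c}) :
      {c : List ℕ // IsComp r.sum c ∧ CompLe c r} :=
    ⟨(List.ofFn fun j => (f j).1).flatten, ⟨by
      intro x hx
      simp only [List.mem_flatten, List.mem_ofFn, exists_exists_eq_and] at hx
      obtain ⟨j, hx⟩ := hx
      exact (f j).2.1 _ hx, (hle f).sum_eq⟩, hle f⟩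
  have hg : Function.Bijective g := by
    constructor
    · intro f f' h
      funext j
      exact Subtype.ext (flatten_ofFn_injective_of_sum _ _
        (fun j => (f j).2.2.trans (f' j).2.2.symm) (fun j => (f j).2.1) (fun j => (f' j).2.1)
        (congrArg Subtype.val h) j)
    · rintro ⟨c, hc, K, rfl, rfl⟩
      refine ⟨fun j => ⟨K.get (j.cast (by simp)), fun x hx => hc.1 x ?_, by simp⟩, ?_⟩
      · exact List.mem_flatten_of_mem (List.get_mem _ _) hx
      · apply Subtype.ext
        change (List.ofFn _).flatten = K.flatten
        congr 1
        apply List.ext_get <;> simp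
  refine ⟨(Equiv.ofBijective g hg).symm, fun c c' => ?_⟩
  obtain ⟨f, rfl⟩ := (Equiv.ofBijective g hg).surjective c
  obtain ⟨f', rfl⟩ := (Equiv.ofBijective g hg).surjective c'
  simp only [Equiv.symm_apply_apply]
  exact compLe_flatten_ofFn _ _ (fun j => (f j).2.2.trans (f' j).2.2.symm) (fun j => (f j).2.1)

end Compositions

section Runs

variable {α : Type*} {r : α → α → Bool}

theorem exists_regroup_splitBy (R L : List (List α))
    (hL : ∀ p ∈ L, p ≠ []) (hc : ∀ p ∈ L, p.IsChain (r · ·))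
    (hR : R.IsChain fun a b => ∃ ha hb, r (a.getLast ha) (b.head hb) = false)
    (hn : [] ∉ R) (h : L.flatten = R.flatten) :
    ∃ N : List (List (List α)), N.flatten = L ∧ N.map List.flatten = R := by
  induction R generalizing L with
  | nil =>
    refine ⟨[], ?_, rfl⟩
    cases L with
    | nil => rfl
    | cons p L => simp at h; exact absurd h.1 (hL p (by simp))
  | cons a R ih =>
    have key : ∃ as bs, L = as ++ bs ∧ a = as.flatten ∧ R.flatten = bs.flatten := by
      rw [List.flatten_cons, List.flatten_eq_append_iff] at h
      obtain h | ⟨as, bs, c, cs, ds, rfl, ha, hz⟩ := h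
      · exact h
      obtain rfl | hbs := eq_or_ne bs []
      · exact ⟨as, (c :: cs) :: ds, by simp, by simpa using ha, by simpa using hz⟩
      exfalso
      cases R with
      | nil => simp at hz
      | cons b R =>
        obtain ⟨hx, hb, hab⟩ := (List.isChain_cons_cons.1 hR).1
        subst ha
        obtain ⟨d, b, rfl⟩ := List.exists_cons_of_ne_nil hb
        simp only [List.flatten_cons, List.cons_append, List.cons.injEq] at hz
        obtain ⟨rfl, -⟩ := hz
        have := (List.isChain_append.1 (hc (bs ++ d :: cs) (by simp))).2.2
          (bs.getLast hbs) (List.getLast_mem_getLast? hbs) d (by simp)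
        rw [List.getLast_append_of_ne_nil _ hbs] at hab
        simp_all
    obtain ⟨as, bs, rfl, rfl, h'⟩ := key
    obtain ⟨N, rfl, rfl⟩ := ih bs (fun p hp => hL p (by simp [hp])) (fun p hp => hc p (by simp [hp]))
      hR.tail (fun h => hn (by simp [h])) h'.symm
    exact ⟨as :: N, by simp, by simp⟩

theorem compLe_splitBy_iff {L : List (List α)} (hL : ∀ p ∈ L, p ≠ []) :
    CompLe (L.map List.length) ((L.flatten.splitBy r).map List.length) ↔
      ∀ p ∈ L, p.IsChain (r · ·) := by
  constructor
  · rintro ⟨K, h₁, h₂⟩ p hp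
    obtain ⟨N, h₃, h₄⟩ := exists_regroup_splitLengths K L.flatten
      (by rw [h₁, List.length_flatten])
    rw [h₁, splitLengths_map_length] at h₃
    have hsplit : ((L.flatten.splitBy r).map List.length).splitLengths L.flatten
        = L.flatten.splitBy r := by
      conv_lhs => arg 2; rw [← List.flatten_splitBy r L.flatten]
      exact splitLengths_map_length _
    rw [h₂, hsplit] at h₄
    rw [← h₃, List.mem_flatten] at hp
    obtain ⟨q, hq, hpq⟩ := hp
    have : q.flatten ∈ L.flatten.splitBy r := h₄ ▸ List.mem_map_of_mem hq
    obtain ⟨s, t, rfl⟩ := List.append_of_mem hpq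
    have hch := List.isChain_of_mem_splitBy this
    rw [List.flatten_append, List.flatten_cons] at hch
    exact hch.right_of_append.left_of_append
  · intro h
    obtain ⟨N, h₁, h₂⟩ := exists_regroup_splitBy (L.flatten.splitBy r) L hL h
      (List.isChain_getLast_head_splitBy _ _) (List.nil_notMem_splitBy _ _)
      (List.flatten_splitBy _ _).symm
    refine ⟨N.map (List.map List.length), by rw [← h₁, List.map_flatten], ?_⟩
    rw [← h₂]
    simp [Function.comp_def, List.length_flatten]

end Runs

theorem ascL_cons_cons (a b : ℕ) (l : List ℕ) :
    ascL (a :: b :: l) = (if a < b then 1 else 0) + ascL (b :: l) := by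
  by_cases h : a < b <;> simp [ascL, h, add_comm]

theorem ascL_append_of_isChain {p l : List ℕ} (hp : p ≠ []) (hc : p.IsChain (· < ·))
    (hl : ∀ b ∈ l.head?, ¬ p.getLast hp < b) :
    ascL (p ++ l) + 1 = p.length + ascL l := by
  induction p with
  | nil => exact absurd rfl hp
  | cons a p ih =>
    cases p with
    | nil =>
      cases l with
      | nil => simp [ascL]
      | cons b l => simp at hl; simp [ascL_cons_cons, hl.not_gt, add_comm]
    | cons b p =>
      have := ih (by simp) hc.tail (by simpa using hl)
      have hab := (List.isChain_cons_cons.1 hc).1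
      simp only [List.cons_append, List.length_cons, ascL_cons_cons, hab, if_true] at this ⊢
      omega

theorem length_add_ascL_flatten (R : List (List ℕ)) (hc : ∀ p ∈ R, p.IsChain (· < ·))
    (hR : R.IsChain fun a b => ∃ ha hb, ¬ a.getLast ha < b.head hb) (hn : [] ∉ R) :
    R.length + ascL R.flatten = R.flatten.length := by
  induction R with
  | nil => rfl
  | cons p R ih =>
    have := ih (fun q hq => hc q (by simp [hq])) hR.tail (fun h => hn (by simp [h]))
    have h := ascL_append_of_isChain (p := p) (l := R.flatten) (fun h => hn (by simp [h]))
      (hc p (by simp)) (by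
        cases R with
        | nil => simp
        | cons q R =>
          obtain ⟨_, hq, hpq⟩ := (List.isChain_cons_cons.1 hR).1
          obtain ⟨d, q, rfl⟩ := List.exists_cons_of_ne_nil hq
          simpa using hpq)
    simp only [List.flatten_cons, List.length_cons, List.length_append] at this ⊢
    omega

theorem length_ascRunLengths (l : List ℕ) :
    (ascRunLengths l).length = l.length - ascL l := by
  have := length_add_ascL_flatten (l.splitBy fun a b => decide (a < b))
    (fun p hp => by simpa using List.isChain_of_mem_splitBy hp)
    (by simpa using List.isChain_getLast_head_splitBy (fun a b => decide (a < b)) l)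
    (List.nil_notMem_splitBy _ _)
  rw [List.flatten_splitBy] at this
  simp only [ascRunLengths, List.length_map]
  omega

section Blocks

variable {n : ℕ}

theorem mem_unionList {l : List (Block n)} {x : Fin n} :
    x ∈ unionList l ↔ ∃ P ∈ l, x ∈ P := by
  induction l with
  | nil => simp [unionList]
  | cons P l ih =>
    have : unionList (P :: l) = P ∪ unionList l := rfl
    simp [this, ih]

theorem subset_unionList {l : List (Block n)} {P : Block n} (h : P ∈ l) : P ⊆ unionList l :=
  fun _ hx => mem_unionList.2 ⟨P, h, hx⟩

theorem unionList_map_unionList (L : List (List (Block n))) :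
    unionList (L.map unionList) = unionList L.flatten := by
  ext x
  simp only [mem_unionList, List.mem_map, List.mem_flatten]
  constructor
  · rintro ⟨_, ⟨p, hp, rfl⟩, hx⟩
    obtain ⟨P, hP, hx⟩ := mem_unionList.1 hx
    exact ⟨P, ⟨p, hp, hP⟩, hx⟩
  · rintro ⟨P, ⟨p, hp, hP⟩, hx⟩
    exact ⟨_, ⟨p, hp, rfl⟩, mem_unionList.2 ⟨P, hP, hx⟩⟩

theorem IsOSP.eq_of_mem {E : Finset (Fin n)} {l : List (Block n)} (h : IsOSP E l)
    {P Q : Block n} (hP : P ∈ l) (hQ : Q ∈ l) {x : Fin n} (hxP : x ∈ P) (hxQ : x ∈ Q) :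
    P = Q := by
  by_contra hne
  have : Std.Symm fun P Q : Block n => Disjoint P Q := ⟨fun _ _ h => h.symm⟩
  exact Finset.disjoint_left.1 (h.2.1.forall hP hQ hne) hxP hxQ

theorem map_unionList_injective {L L' : List (List (Block n))}
    (hE : (∀ P ∈ L.flatten, P.Nonempty) ∧ L.flatten.Pairwise fun P Q => Disjoint P Q)
    (h : L.flatten = L'.flatten) (hu : L.map unionList = L'.map unionList) : L = L' := by
  induction L generalizing L' with
  | nil => simpa using hu.symm
  | cons p L ih =>
    cases L' with
    | nil => simp at hu
    | cons q L' =>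
      simp only [List.map_cons, List.cons.injEq] at hu
      have aux (a x : List (Block n)) (hne : ∀ P ∈ a ++ x, P.Nonempty)
          (hd : (a ++ x).Pairwise fun P Q => Disjoint P Q)
          (hax : unionList a = unionList (a ++ x)) : x = [] := by
        rw [List.eq_nil_iff_forall_not_mem]
        intro P hP
        obtain ⟨i, hi⟩ := hne P (by simp [hP])
        have : i ∈ unionList a := hax ▸ mem_unionList.2 ⟨P, by simp [hP], hi⟩
        obtain ⟨Q, hQ, hiQ⟩ := mem_unionList.1 this
        exact Finset.disjoint_left.1 ((List.pairwise_append.1 hd).2.2 Q hQ P hP) hiQ hi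
      rw [List.flatten_cons] at hE
      have hpq : p = q ∧ L.flatten = L'.flatten := by
        rw [List.flatten_cons, List.flatten_cons] at h
        obtain ⟨x, hx, hx'⟩ | ⟨x, hx, hx'⟩ := List.append_eq_append_iff.1 h
        · rw [hx', ← List.append_assoc] at hE
          have := aux p x (fun P hP => hE.1 P (List.mem_append_left _ hP))
            (List.pairwise_append.1 hE.2).1 (by rw [hu.1, hx])
          subst this
          exact ⟨by simpa using hx.symm, by simpa using hx'⟩
        · subst hx
          have := aux q x (fun P hP => hE.1 P (List.mem_append_left _ hP))
            (List.pairwise_append.1 hE.2).1 hu.1.symm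
          subst this
          exact ⟨by simp, by simpa using hx'.symm⟩
      obtain ⟨rfl, hL⟩ := hpq
      rw [ih ⟨fun P hP => hE.1 P (List.mem_append_right _ hP), (List.pairwise_append.1 hE.2).2.1⟩
        hL hu.2]

theorem IsOSP.map_unionList {E : Finset (Fin n)} {L : List (List (Block n))}
    (h : IsOSP E L.flatten) (hL : ∀ p ∈ L, p ≠ []) : IsOSP E (L.map unionList) := by
  obtain ⟨h₁, h₂, h₃, h₄⟩ := h
  refine ⟨?_, ?_, ?_, ?_⟩
  · intro P hP
    obtain ⟨p, hp, rfl⟩ := List.mem_map.1 hP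
    obtain ⟨Q, hQ⟩ := List.exists_mem_of_ne_nil _ (hL p hp)
    exact (h₁ Q (List.mem_flatten_of_mem hp hQ)).mono (subset_unionList hQ)
  · rw [List.pairwise_map]
    refine (List.pairwise_flatten.1 h₂).2.imp fun {p q} hpq => ?_
    rw [Finset.disjoint_left]
    intro x hx hx'
    obtain ⟨P, hP, hxP⟩ := mem_unionList.1 hx
    obtain ⟨Q, hQ, hxQ⟩ := mem_unionList.1 hx'
    exact Finset.disjoint_left.1 (hpq P hP Q hQ) hxP hxQ
  · intro P hP x hx
    obtain ⟨p, hp, rfl⟩ := List.mem_map.1 hP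
    obtain ⟨Q, hQ, hxQ⟩ := mem_unionList.1 hx
    exact h₃ Q (List.mem_flatten_of_mem hp hQ) hxQ
  · intro i hi
    obtain ⟨Q, hQ, hiQ⟩ := h₄ i hi
    obtain ⟨p, hp, hQp⟩ := List.mem_flatten.1 hQ
    exact ⟨_, List.mem_map_of_mem hp, mem_unionList.2 ⟨Q, hQp, hiQ⟩⟩

theorem IsOSP.ne_nil_of_map_unionList {E : Finset (Fin n)} {L : List (List (Block n))}
    (h : IsOSP E (L.map unionList)) : ∀ p ∈ L, p ≠ [] := by
  rintro p hp rfl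
  simpa [unionList] using h.1 _ (List.mem_map_of_mem hp)

/-- Merge consecutive blocks of `τ` into groups whose sizes are the parts of `c`. -/
def glue (τ : List (Block n)) (c : List ℕ) : List (Block n) :=
  (c.splitLengths τ).map unionList

theorem IsOSP.glue {E : Finset (Fin n)} {τ : List (Block n)} (h : IsOSP E τ) {c : List ℕ}
    (hc : IsComp τ.length c) : IsOSP E (glue τ c) := by
  refine IsOSP.map_unionList ?_ hc.ne_nil_of_mem_splitLengths
  rwa [hc.flatten_splitLengths]

theorem ospLe_glue {τ : List (Block n)} {c : List ℕ} (hc : IsComp τ.length c) :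
    OSPle τ (glue τ c) :=
  ⟨_, hc.flatten_splitLengths, rfl⟩

theorem glue_injective {E : Finset (Fin n)} {τ : List (Block n)} (h : IsOSP E τ) {c c' : List ℕ}
    (hc : IsComp τ.length c) (hc' : IsComp τ.length c') (hcc : glue τ c = glue τ c') :
    c = c' := by
  rw [← hc.map_length_splitLengths, ← hc'.map_length_splitLengths]
  congr 1
  refine map_unionList_injective ?_ ?_ hcc
  · rw [hc.flatten_splitLengths]
    exact ⟨h.1, h.2.1⟩
  · rw [hc.flatten_splitLengths, hc'.flatten_splitLengths]

theorem exists_glue_of_ospLe {E : Finset (Fin n)} {τ σ : List (Block n)} (hσ : IsOSP E σ)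
    (h : OSPle τ σ) : ∃ c, IsComp τ.length c ∧ glue τ c = σ := by
  obtain ⟨L, rfl, rfl⟩ := h
  exact ⟨L.map List.length, isComp_map_length hσ.ne_nil_of_map_unionList,
    by rw [glue, splitLengths_map_length]⟩

theorem ospLe_glue_glue_iff {E : Finset (Fin n)} {τ : List (Block n)} (h : IsOSP E τ)
    {c c' : List ℕ} (hc : IsComp τ.length c) (hc' : IsComp τ.length c') :
    OSPle (glue τ c) (glue τ c') ↔ CompLe c c' := by
  constructor
  · rintro ⟨L, hL, hLc'⟩
    obtain ⟨N, hN, rfl⟩ := exists_flatten_eq_of_map_eq_flatten hL.symm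
    have hN' : N.map List.flatten = c'.splitLengths τ := by
      refine map_unionList_injective ?_ ?_ ?_
      · rw [← List.flatten_flatten, hN, hc.flatten_splitLengths]
        exact ⟨h.1, h.2.1⟩
      · rw [← List.flatten_flatten, hN, hc.flatten_splitLengths, hc'.flatten_splitLengths]
      · rw [← glue, hLc']
        simp [unionList_map_unionList]
    refine ⟨N.map (List.map List.length), ?_, ?_⟩
    · rw [← List.map_flatten, hN, hc.map_length_splitLengths]
    · rw [← hc'.map_length_splitLengths, ← hN']
      simp [Function.comp_def, List.length_flatten]
  · rintro ⟨K, rfl, rfl⟩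
    obtain ⟨N, h₁, h₂⟩ := exists_regroup_splitLengths K τ hc.2
    refine ⟨N.map (List.map unionList), ?_, ?_⟩
    · rw [glue, ← h₁, List.map_flatten]
    · rw [glue, ← h₂]
      simp [unionList_map_unionList]

end Blocks

section IntervalPartitions

variable {m : ℕ}

theorem IsOSP.isIP_iff {l : List (Finset (Fin m))} (h : IsOSP Finset.univ l) :
    IsIP l ↔ l.Pairwise fun P Q => ∀ a ∈ P, ∀ b ∈ Q, a < b := by
  refine ⟨fun hl => ?_, fun hl => ⟨h, hl.isChain⟩⟩
  have hne := h.1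
  have hc := hl.2
  clear h hl
  induction l with
  | nil => exact List.Pairwise.nil
  | cons P l ih =>
    have hl := ih (fun Q hQ => hne Q (by simp [hQ])) hc.tail
    refine List.pairwise_cons.2 ⟨fun Q hQ a ha b hb => ?_, hl⟩
    cases l with
    | nil => simp at hQ
    | cons R l =>
      have hPR := (List.isChain_cons_cons.1 hc).1
      obtain rfl | hQ := List.mem_cons.1 hQ
      · exact hPR a ha b hb
      · obtain ⟨c, hc⟩ := hne R (by simp)
        exact (hPR a ha c hc).trans ((List.pairwise_cons.1 hl).1 Q hQ c hc b hb)

theorem OSPle.refines {l l' : List (Finset (Fin m))} (h : OSPle l l') : refines l l' := by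
  obtain ⟨L, rfl, rfl⟩ := h
  intro P hP
  obtain ⟨p, hp, hPp⟩ := List.mem_flatten.1 hP
  exact ⟨_, List.mem_map_of_mem hp, subset_unionList hPp⟩

theorem IsIP.ospLe_iff_refines {l l' : List (Finset (Fin m))} (hl : IsIP l) (hl' : IsIP l') :
    OSPle l l' ↔ refines l l' := by
  refine ⟨OSPle.refines, fun h => ?_⟩
  have hp := hl.1.isIP_iff.1 hl
  have hp' := hl'.1.isIP_iff.1 hl'
  let r (P Q : Finset (Fin m)) : Prop := P.Nonempty ∧ Q.Nonempty ∧ ∀ a ∈ P, ∀ b ∈ Q, a < b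
  have hasymm : Std.Asymm r := ⟨by
    rintro P Q ⟨⟨a, ha⟩, ⟨b, hb⟩, h⟩ ⟨-, -, h'⟩
    exact (h a ha b hb).asymm (h' b hb a ha)⟩
  have hlr : l.Pairwise r :=
    hp.imp_of_mem fun {P Q} hP hQ hPQ => ⟨hl.1.1 P hP, hl.1.1 Q hQ, hPQ⟩
  refine ⟨l'.map fun Q => l.filter fun P => decide (P ⊆ Q), ?_, ?_⟩
  · refine List.Pairwise.eq_of_mem_iff (r := r) ?_ hlr fun P => ?_
    · rw [List.pairwise_flatten]
      constructor
      · intro p hp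
        obtain ⟨Q, -, rfl⟩ := List.mem_map.1 hp
        exact hlr.filter _
      · rw [List.pairwise_map]
        refine hp'.imp fun {Q Q'} hQ P hP P' hP' => ?_
        simp only [List.mem_filter, decide_eq_true_eq] at hP hP'
        exact ⟨hl.1.1 P hP.1, hl.1.1 P' hP'.1, fun a ha b hb => hQ a (hP.2 ha) b (hP'.2 hb)⟩
    · simp only [List.mem_flatten, List.mem_map, exists_exists_and_eq_and, List.mem_filter,
        decide_eq_true_eq]
      constructor
      · rintro ⟨Q, -, hP, -⟩
        exact hP
      · intro hP
        obtain ⟨Q, hQ, hPQ⟩ := h P hP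
        exact ⟨Q, hQ, hP, hPQ⟩
  · rw [List.map_map]
    refine (List.map_id l').symm.trans (List.map_congr_left fun Q hQ => ?_)
    ext x
    simp only [id, Function.comp_apply, mem_unionList, List.mem_filter, decide_eq_true_eq]
    constructor
    · intro hx
      obtain ⟨P, hP, hxP⟩ := hl.1.2.2.2 x (Finset.mem_univ x)
      obtain ⟨Q', hQ', hPQ'⟩ := h P hP
      obtain rfl := hl'.1.eq_of_mem hQ hQ' hx (hPQ' hxP)
      exact ⟨P, ⟨hP, hPQ'⟩, hxP⟩
    · rintro ⟨P, ⟨-, hPQ⟩, hxP⟩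
      exact hPQ hxP

theorem IsIP.map_unionList {L : List (List (Finset (Fin m)))} (h : IsIP L.flatten)
    (hL : ∀ p ∈ L, p ≠ []) : IsIP (L.map unionList) := by
  have hp := h.1.isIP_iff.1 h
  rw [(h.1.map_unionList hL).isIP_iff, List.pairwise_map]
  refine (List.pairwise_flatten.1 hp).2.imp fun {p q} hpq a ha b hb => ?_
  obtain ⟨P, hP, haP⟩ := mem_unionList.1 ha
  obtain ⟨Q, hQ, hbQ⟩ := mem_unionList.1 hb
  exact hpq P hP Q hQ a haP b hbQ

/-- The finest interval partition of `[m]`. -/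
def singletons (m : ℕ) : List (Finset (Fin m)) := (List.finRange m).map ({·})

theorem isIP_singletons (m : ℕ) : IsIP (singletons m) := by
  have h : IsOSP Finset.univ (singletons m) := by
    refine ⟨by simp [singletons], ?_, by simp, by simp [singletons]⟩
    simpa [singletons, List.pairwise_map] using List.nodup_iff_pairwise_ne.1 (List.nodup_finRange m)
  rw [h.isIP_iff]
  simpa [singletons, List.pairwise_map] using List.pairwise_lt_finRange m

theorem refines_singletons {l : List (Finset (Fin m))} (h : IsOSP Finset.univ l) :
    refines (singletons m) l := by
  intro P hP
  obtain ⟨i, -, rfl⟩ := List.mem_map.1 hP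
  simpa using h.2.2.2 i (Finset.mem_univ i)

theorem exists_equiv_isIP (m : ℕ) :
    ∃ e : {c : List ℕ // IsComp m c} ≃ {l : List (Finset (Fin m)) // IsIP l},
      ∀ c c', CompLe c.1 c'.1 ↔ refines (e c).1 (e c').1 := by
  have hs := isIP_singletons m
  have hm : (singletons m).length = m := by simp [singletons]
  have hIP {c : List ℕ} (hc : IsComp m c) : IsIP (glue (singletons m) c) := by
    rw [← hm] at hc
    refine IsIP.map_unionList ?_ hc.ne_nil_of_mem_splitLengths
    rwa [hc.flatten_splitLengths]
  let g (c : {c : List ℕ // IsComp m c}) : {l : List (Finset (Fin m)) // IsIP l} :=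
    ⟨glue (singletons m) c.1, hIP c.2⟩
  have hg : Function.Bijective g := by
    constructor
    · intro c c' h
      exact Subtype.ext (glue_injective hs.1 (hm.symm ▸ c.2) (hm.symm ▸ c'.2)
        (congrArg Subtype.val h))
    · intro l
      obtain ⟨c, hc, h⟩ := exists_glue_of_ospLe l.2.1
        ((hs.ospLe_iff_refines l.2).2 (refines_singletons l.2.1))
      exact ⟨⟨c, hm ▸ hc⟩, Subtype.ext h⟩
  refine ⟨Equiv.ofBijective g hg, fun c c' => ?_⟩
  rw [← ospLe_glue_glue_iff hs.1 (hm.symm ▸ c.2) (hm.symm ▸ c'.2)]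
  exact (hIP c.2).ospLe_iff_refines (hIP c'.2)

end IntervalPartitions

section QuasiMeet

variable {n : ℕ}

theorem IsOSP.findIdx_eq_of_subset {E : Finset (Fin n)} {η : List (Block n)} (hη : IsOSP E η)
    {i : ℕ} (hi : i < η.length) {T : Block n} (hT : T.Nonempty) (hTi : T ⊆ η[i]) :
    (η.findIdx fun E => decide (T ⊆ E)) = i := by
  rw [List.findIdx_eq hi]
  refine ⟨by simpa using hTi, fun j hj => ?_⟩
  simp only [decide_eq_false_iff_not]
  intro hTj
  obtain ⟨x, hx⟩ := hT
  exact Finset.disjoint_left.1 (List.pairwise_iff_getElem.1 hη.2.1 j i (by omega) hi hj)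
    (hTj hx) (hTi hx)

theorem mem_restrict {η : List (Block n)} {U T : Block n} :
    T ∈ restrict η U ↔ T.Nonempty ∧ ∃ Q ∈ η, Q ∩ U = T := by
  simp [restrict, Finset.nonempty_iff_ne_empty, and_comm]

theorem pairwise_restrict {E : Finset (Fin n)} {η : List (Block n)} (hη : IsOSP E η)
    (U : Block n) :
    (restrict η U).Pairwise fun T T' =>
      (η.findIdx fun E => decide (T ⊆ E)) < η.findIdx fun E => decide (T' ⊆ E) := by
  rw [restrict, List.pairwise_filter, List.pairwise_map, List.pairwise_iff_getElem]
  intro i j hi hj hij hU hU'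
  simp only [← Finset.nonempty_iff_ne_empty, decide_eq_true_eq] at hU hU'
  rwa [hη.findIdx_eq_of_subset hi hU Finset.inter_subset_left,
    hη.findIdx_eq_of_subset hj hU' Finset.inter_subset_left]

theorem unionList_restrict {η : List (Block n)} (hη : IsOSP Finset.univ η) (U : Block n) :
    unionList (restrict η U) = U := by
  ext x
  simp only [mem_unionList, mem_restrict]
  constructor
  · rintro ⟨_, ⟨-, Q, -, rfl⟩, hx⟩
    exact (Finset.mem_inter.1 hx).2
  · intro hx
    obtain ⟨Q, hQ, hxQ⟩ := hη.2.2.2 x (Finset.mem_univ x)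
    have : x ∈ Q ∩ U := Finset.mem_inter.2 ⟨hxQ, hx⟩
    exact ⟨Q ∩ U, ⟨⟨x, this⟩, Q, hQ, rfl⟩, this⟩

theorem restrict_unionList {E : Finset (Fin n)} {η : List (Block n)} (hη : IsOSP E η)
    {p : List (Block n)} (hne : ∀ T ∈ p, T.Nonempty) (href : refines p η)
    (hp : p.Pairwise fun T T' =>
      (η.findIdx fun E => decide (T ⊆ E)) < η.findIdx fun E => decide (T' ⊆ E)) :
    restrict η (unionList p) = p := by
  let idx (T : Block n) : ℕ := η.findIdx fun E => decide (T ⊆ E)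
  have hasymm : Std.Asymm fun T T' : Block n => idx T < idx T' := ⟨fun _ _ => lt_asymm⟩
  have hinj {T T' : Block n} (hT : T ∈ p) (hT' : T' ∈ p) (h : idx T = idx T') : T = T' := by
    have hp' : p.Pairwise fun T T' => idx T ≠ idx T' := hp.imp fun h => h.ne
    have : Std.Symm fun T T' : Block n => idx T ≠ idx T' := ⟨fun _ _ h => h.symm⟩
    by_contra hne
    exact hp'.forall hT hT' hne h
  have hinter {T Q : Block n} (hT : T ∈ p) (hQ : Q ∈ η) (hTQ : T ⊆ Q) :
      Q ∩ unionList p = T := by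
    refine Finset.Subset.antisymm (fun x hx => ?_)
      (Finset.subset_inter hTQ (subset_unionList hT))
    obtain ⟨hxQ, hx⟩ := Finset.mem_inter.1 hx
    obtain ⟨T', hT', hxT'⟩ := mem_unionList.1 hx
    obtain ⟨Q', hQ', hTQ'⟩ := href T' hT'
    obtain rfl := hη.eq_of_mem hQ hQ' hxQ (hTQ' hxT')
    obtain ⟨i, hi, rfl⟩ := List.getElem_of_mem hQ
    obtain rfl := hinj hT hT' ((hη.findIdx_eq_of_subset hi (hne T hT) hTQ).trans
      (hη.findIdx_eq_of_subset hi (hne T' hT') hTQ').symm)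
    exact hxT'
  refine (pairwise_restrict hη _).eq_of_mem_iff (r := fun T T' => idx T < idx T') hp fun T => ?_
  rw [mem_restrict]
  constructor
  · rintro ⟨⟨x, hx⟩, Q, hQ, rfl⟩
    obtain ⟨hxQ, hx'⟩ := Finset.mem_inter.1 hx
    obtain ⟨T, hT, hxT⟩ := mem_unionList.1 hx'
    obtain ⟨Q', hQ', hTQ'⟩ := href T hT
    obtain rfl := hη.eq_of_mem hQ hQ' hxQ (hTQ' hxT)
    rwa [hinter hT hQ hTQ']
  · intro hT
    obtain ⟨Q, hQ, hTQ⟩ := href T hT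
    exact ⟨hne T hT, Q, hQ, hinter hT hQ hTQ⟩

theorem qmeet_map_unionList_eq_iff {η : List (Block n)} (hη : IsOSP Finset.univ η)
    {L : List (List (Block n))} (hL : IsOSP Finset.univ L.flatten)
    (href : refines L.flatten η) :
    qmeet (L.map unionList) η = L.flatten ↔
      ∀ p ∈ L, (p.map fun T => η.findIdx fun E => decide (T ⊆ E)).IsChain (· < ·) := by
  have hchain (p : List (Block n)) :
      (p.map fun T => η.findIdx fun E => decide (T ⊆ E)).IsChain (· < ·) ↔ p.Pairwise
        fun T T' => (η.findIdx fun E => decide (T ⊆ E)) < η.findIdx fun E => decide (T' ⊆ E) := by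
    rw [List.isChain_iff_pairwise, List.pairwise_map]
  simp only [hchain, qmeet, List.map_map]
  constructor
  · intro h
    have hL' := map_unionList_injective ⟨hL.1, hL.2.1⟩ h.symm (by
      simp [Function.comp_def, unionList_restrict hη])
    intro p hp
    rw [hL'] at hp
    obtain ⟨q, -, rfl⟩ := List.mem_map.1 hp
    exact pairwise_restrict hη _
  · intro h
    congr 1
    refine (List.map_congr_left fun p hp => ?_).trans (List.map_id L)
    exact restrict_unionList hη (fun T hT => hL.1 T (List.mem_flatten_of_mem hp hT))
      (fun T hT => href T (List.mem_flatten_of_mem hp hT)) (h p hp)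

theorem ospLe_of_qmeet_eq {τ η σ : List (Block n)} (hη : IsOSP Finset.univ η)
    (h : qmeet σ η = τ) : OSPle τ σ :=
  ⟨_, h, by simp [Function.comp_def, unionList_restrict hη]⟩

theorem isComp_ascRunLengths (l : List ℕ) : IsComp l.length (ascRunLengths l) := by
  conv_lhs => rw [← List.flatten_splitBy (fun a b => decide (a < b)) l]
  exact isComp_map_length fun p hp => List.ne_nil_of_mem_splitBy hp

theorem qmeet_glue_eq_iff {τ η : List (Block n)} (hτ : IsOSP Finset.univ τ)
    (hη : IsOSP Finset.univ η) (hbar : refines τ η) {c : List ℕ} (hc : IsComp τ.length c) :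
    qmeet (glue τ c) η = τ ↔ CompLe c (ascRunLengths (mseq τ η)) := by
  have hfl := hc.flatten_splitLengths
  have hq := qmeet_map_unionList_eq_iff hη (L := c.splitLengths τ) (by rwa [hfl]) (by rwa [hfl])
  rw [hfl, ← glue] at hq
  rw [hq]
  set f := fun T : Block n => η.findIdx fun E => decide (T ⊆ E)
  have hr := compLe_splitBy_iff (r := fun a b : ℕ => decide (a < b))
    (L := (c.splitLengths τ).map (List.map f))
    (by simpa using hc.ne_nil_of_mem_splitLengths)
  have hlen : ((c.splitLengths τ).map (List.map f)).map List.length = c := by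
    simpa [Function.comp_def] using hc.map_length_splitLengths
  rw [hlen, ← List.map_flatten, hfl] at hr
  simpa [ascRunLengths, mseq] using hr.symm

end QuasiMeet

/-- Let `τ, η ∈ OP_n` with `τ̄ ≤ η̄`. Then there is `σ_max ∈ OP_n` with
`{σ ∈ OP_n : σ⋏η = τ} = {σ ∈ OP_n : τ ≤ σ ≤ σ_max}`; moreover this set (with the induced order)
is order-isomorphic to the product poset `IP_{p₁} × ⋯ × IP_{p_t}`, where `p₁,…,p_t` are the
lengths of the ascending runs of the sequence `(m₁,…,m_s)` and `t = |τ| − asc_η(τ)`. -/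
theorem statement13 {n : ℕ} (τ η : List (Block n))
    (hτ : IsOSP Finset.univ τ) (hη : IsOSP Finset.univ η) (hbar : refines τ η) :
    ∃ σmax : List (Block n), IsOSP Finset.univ σmax ∧
      ({σ : List (Block n) | IsOSP Finset.univ σ ∧ qmeet σ η = τ}
        = {σ : List (Block n) | IsOSP Finset.univ σ ∧ OSPle τ σ ∧ OSPle σ σmax}) ∧
      (ascRunLengths (mseq τ η)).length = τ.length - ascN τ η ∧
      ∃ Φ : {σ : List (Block n) // IsOSP Finset.univ σ ∧ qmeet σ η = τ} →
          ((j : Fin (ascRunLengths (mseq τ η)).length) →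
            {l : List (Finset (Fin ((ascRunLengths (mseq τ η)).get j))) // IsIP l}),
        Function.Bijective Φ ∧
        ∀ σ σ', OSPle σ.val σ'.val ↔ ∀ j, refines ((Φ σ) j).val ((Φ σ') j).val := by
  have hlen : (mseq τ η).length = τ.length := by simp [mseq]
  have hr := isComp_ascRunLengths (mseq τ η)
  rw [hlen] at hr
  set r := ascRunLengths (mseq τ η) with hr_def
  refine ⟨glue τ r, hτ.glue hr, ?_, ?_, ?_⟩
  · ext σ
    refine and_congr_right fun hσ => ⟨fun h => ?_, fun ⟨h, h'⟩ => ?_⟩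
    · have hle := ospLe_of_qmeet_eq hη h
      obtain ⟨c, hc, rfl⟩ := exists_glue_of_ospLe hσ hle
      exact ⟨hle, (ospLe_glue_glue_iff hτ hc hr).2 ((qmeet_glue_eq_iff hτ hη hbar hc).1 h)⟩
    · obtain ⟨c, hc, rfl⟩ := exists_glue_of_ospLe hσ h
      exact (qmeet_glue_eq_iff hτ hη hbar hc).2 ((ospLe_glue_glue_iff hτ hc hr).1 h')
  · rw [hr_def, length_ascRunLengths, hlen, ascN]
  · let g (c : {c : List ℕ // IsComp r.sum c ∧ CompLe c r}) :
        {σ : List (Block n) // IsOSP Finset.univ σ ∧ qmeet σ η = τ} :=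
      ⟨glue τ c.1, hτ.glue (hr.2 ▸ c.2.1),
        (qmeet_glue_eq_iff hτ hη hbar (hr.2 ▸ c.2.1)).2 c.2.2⟩
    have hg : Function.Bijective g := by
      constructor
      · intro c c' h
        exact Subtype.ext (glue_injective hτ (hr.2 ▸ c.2.1) (hr.2 ▸ c'.2.1)
          (congrArg Subtype.val h))
      · rintro ⟨σ, hσ, h⟩
        obtain ⟨c, hc, rfl⟩ := exists_glue_of_ospLe hσ (ospLe_of_qmeet_eq hη h)
        exact ⟨⟨c, hr.2.symm ▸ hc, (qmeet_glue_eq_iff hτ hη hbar hc).1 h⟩, rfl⟩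
    obtain ⟨e, he⟩ := exists_equiv_compLe r
    choose ip hip using exists_equiv_isIP
    let G := Equiv.ofBijective g hg
    let Φ := G.symm.trans (e.trans (Equiv.piCongrRight fun j => ip (r.get j)))
    refine ⟨Φ, Φ.bijective, fun σ σ' => ?_⟩
    obtain ⟨c, rfl⟩ := G.surjective σ
    obtain ⟨c', rfl⟩ := G.surjective σ'
    have hΦ (c) (j) : Φ (G c) j = ip (r.get j) (e c j) := by simp [Φ]
    simp only [hΦ, ← hip, ← he]
    exact ospLe_glue_glue_iff hτ (hr.2 ▸ c.2.1) (hr.2 ▸ c'.2.1)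

end OSPpaper
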